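/- Let ρ > 0 be a real number, m ≥ 1 a natural number, and p : {1,…,m} → ℕ. Define u : ℝᵐ → ℝ (Euclidean space) by u(y) = ∏_{i=1}^{m} He_{p_i}(√ρ·y_i). Then for every y ∈ ℝᵐ, Δu(y) − ρ·⟨y, ∇u(y)⟩ = −ρ·(∑_{i=1}^{m} p_i)·u(y). Since ∇f(y) = ρy for f(y) = (ρ/2)‖y‖², this realizes the eigenvalues ρ·∑ p_i of −Δ_f on the Gaussian shrinker claimed in Theorem 5.3 (and Lemma 5.2 for m = 1) of the paper. -/

import Mathlib

open scoped RealInnerProductSpace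
open Polynomial

/-- The Euclidean Laplacian of `u` at `x`: the sum of the pure second derivatives
in the standard coordinate directions. -/
noncomputable def lap {ι : Type*} [Fintype ι] [DecidableEq ι]
    (u : EuclideanSpace ℝ ι → ℝ) (x : EuclideanSpace ℝ ι) : ℝ :=
  ∑ i, fderiv ℝ (fun y => fderiv ℝ u y (EuclideanSpace.single i 1)) x
    (EuclideanSpace.single i 1)

namespace Polynomial

/-- Hermite's differential equation `He_n'' = x He_n' - n He_n`. -/
theorem derivative_derivative_hermite (n : ℕ) :
    derivative (derivative (hermite n)) =
      X * derivative (hermite n) - (n : ℤ[X]) * hermite n := by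
  induction n with
  | zero => simp
  | succ n ih =>
    have h : derivative (hermite (n + 1)) = ((n : ℤ[X]) + 1) * hermite n := by
      rw [hermite_succ, derivative_sub, derivative_mul, derivative_X, ih]
      ring
    have h' : derivative (derivative (hermite (n + 1))) =
        ((n : ℤ[X]) + 1) * derivative (hermite n) := by
      rw [h, derivative_mul]
      simp
    rw [h', h, hermite_succ]
    push_cast
    ring

end Polynomial

section ProductOfPolynomials

variable {ι : Type*} [Fintype ι]

theorem differentiable_prod_aeval (c : ℝ) (P : ι → ℤ[X]) :
    Differentiable ℝ fun y : EuclideanSpace ℝ ι => ∏ i, aeval (c * y i) (P i) := by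
  have h (i : ι) : Differentiable ℝ fun y : EuclideanSpace ℝ ι => aeval (c * y i) (P i) :=
    Differentiable.comp (g := fun x : ℝ => aeval x (P i)) (P i).differentiable_aeval
      (f := fun y : EuclideanSpace ℝ ι => c * y i) (by fun_prop)
  fun_prop

variable [DecidableEq ι]

theorem prod_aeval_update (x : ι → ℝ) (P : ι → ℤ[X]) (i : ι) (Q : ℤ[X]) :
    ∏ j, aeval (x j) (Function.update P i Q j) =
      aeval (x i) Q * ∏ j ∈ Finset.univ.erase i, aeval (x j) (P j) := by
  rw [← Finset.mul_prod_erase _ _ (Finset.mem_univ i), Function.update_self]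
  congr 1
  refine Finset.prod_congr rfl fun j hj => ?_
  rw [Function.update_of_ne (Finset.ne_of_mem_erase hj)]

/-- The `i`-th partial derivative of a product of polynomials in the separate (rescaled)
coordinates differentiates the `i`-th factor. -/
theorem fderiv_prod_aeval_single (c : ℝ) (P : ι → ℤ[X]) (y : EuclideanSpace ℝ ι) (i : ι) :
    fderiv ℝ (fun y : EuclideanSpace ℝ ι => ∏ j, aeval (c * y j) (P j)) y
        (EuclideanSpace.single i 1) =
      c * ∏ j, aeval (c * y j) (Function.update P i (derivative (P i)) j) := by
  rw [← (differentiable_prod_aeval c P y).lineDeriv_eq_fderiv, prod_aeval_update]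
  refine HasDerivAt.deriv ?_
  have hconst (t : ℝ) :
      ∏ j, aeval (c * (y + t • EuclideanSpace.single i (1 : ℝ)) j) (P j) =
        aeval (c * (y i + t)) (P i) *
          ∏ j ∈ Finset.univ.erase i, aeval (c * y j) (P j) := by
    rw [← Finset.mul_prod_erase _ _ (Finset.mem_univ i)]
    congr 1
    · simp
    · refine Finset.prod_congr rfl fun j hj => ?_
      simp [Finset.ne_of_mem_erase hj]
  simp only [hconst]
  have hlin : HasDerivAt (fun t : ℝ => c * (y i + t)) c 0 := by
    simpa using ((hasDerivAt_id (0 : ℝ)).const_add (y i)).const_mul c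
  have h := (((P i).hasDerivAt_aeval (c * (y i + 0))).comp (0 : ℝ) hlin).mul_const
    (∏ j ∈ Finset.univ.erase i, aeval (c * y j) (P j))
  refine h.congr_deriv ?_
  rw [add_zero]
  ring

theorem fderiv_fderiv_prod_aeval_single (c : ℝ) (P : ι → ℤ[X]) (y : EuclideanSpace ℝ ι)
    (i : ι) :
    fderiv ℝ (fun z => fderiv ℝ (fun y : EuclideanSpace ℝ ι => ∏ j, aeval (c * y j) (P j)) z
        (EuclideanSpace.single i 1)) y (EuclideanSpace.single i 1) =
      c ^ 2 * ∏ j, aeval (c * y j) (Function.update P i (derivative (derivative (P i))) j) := by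
  simp only [fderiv_prod_aeval_single]
  rw [fderiv_const_mul (differentiable_prod_aeval c _ y), smul_apply,
    fderiv_prod_aeval_single, Function.update_self, Function.update_idem, smul_eq_mul]
  ring

end ProductOfPolynomials

theorem inner_gradient_eq_sum {ι : Type*} [Fintype ι] [DecidableEq ι]
    (u : EuclideanSpace ℝ ι → ℝ) (y : EuclideanSpace ℝ ι) :
    ⟪y, gradient u y⟫ = ∑ i, y i * fderiv ℝ u y (EuclideanSpace.single i 1) := by
  rw [real_inner_comm, gradient, InnerProductSpace.toDual_symm_apply]
  have h := congrArg (fderiv ℝ u y) ((EuclideanSpace.basisFun ι ℝ).sum_repr y)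
  rw [← h]
  simp

/-- Gaussian-shrinker eigenfunction claim of Theorem 5.3 (and Lemma 5.2 for `m = 1`):
for `ρ > 0`, the function `u(y) = ∏ He_{p_i}(√ρ y_i)` satisfies
`Δu - ρ⟨y, ∇u⟩ = -ρ(∑ p_i) u`. -/
theorem gaussian_shrinker_eigenfunction (ρ : ℝ) (hρ : 0 < ρ) (m : ℕ) (hm : 1 ≤ m)
    (p : Fin m → ℕ) (u : EuclideanSpace ℝ (Fin m) → ℝ)
    (hu : ∀ y : EuclideanSpace ℝ (Fin m), u y =
      ∏ i, aeval (Real.sqrt ρ * y i) (hermite (p i))) :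
    ∀ y : EuclideanSpace ℝ (Fin m),
      lap u y - ρ * ⟪y, gradient u y⟫ = -ρ * (∑ i, (p i : ℝ)) * u y := by
  intro y
  obtain rfl : u = fun y => ∏ i, aeval (Real.sqrt ρ * y i) (hermite (p i)) := funext hu
  rw [lap, inner_gradient_eq_sum, Finset.mul_sum, ← Finset.sum_sub_distrib, Finset.mul_sum,
    Finset.sum_mul]
  refine Finset.sum_congr rfl fun i _ => ?_
  beta_reduce
  rw [fderiv_fderiv_prod_aeval_single _ fun i => hermite (p i),
    fderiv_prod_aeval_single _ fun i => hermite (p i), prod_aeval_update (fun j => √ρ * y j),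
    prod_aeval_update (fun j => √ρ * y j), derivative_derivative_hermite,
    ← Finset.mul_prod_erase _ _ (Finset.mem_univ i), Real.sq_sqrt hρ.le]
  simp only [map_sub, map_mul, aeval_X, map_natCast]
  ring
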